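/- For any function f : 2^{<ω} → ℕ, either LK(f) = 2^ω or there exists a real A with A ∈ KT(Δ⁰₂) and A ∉ LK(f). -/

import Mathlib

/-! Common framework: prefix-free Kolmogorov complexity via a universal
prefix-free oracle machine, Δ⁰₂ functions and orders, Turing and wtt
reducibility, Ω, and the uniform measure on Cantor space. -/

/-- Finite binary strings, `2^{<ω}`. -/
abbrev BinStr := List Bool

/-- Reals, i.e. infinite binary sequences `2^ω`. -/
abbrev Seq2 := ℕ → Bool

/-- The initial segment `A↾n` of a real `A ∈ 2^ω`. -/
def restrict (A : Seq2) (n : ℕ) : BinStr := (List.range n).map A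

/-- A prefix-free oracle machine, presented as a computable enumeration of
axioms `(τ, p, y)`, meaning: on any oracle extending `τ`, the machine halts on
program `p` with output `y`.  Consistency says that for compatible oracle
strings the halting programs form a prefix-free set and outputs are unique. -/
structure PrefixOracleMachine where
  axioms : ℕ → Option (BinStr × BinStr × BinStr)
  axioms_computable : Computable axioms
  consistent : ∀ s t τ₁ p₁ y₁ τ₂ p₂ y₂,
    axioms s = some (τ₁, p₁, y₁) → axioms t = some (τ₂, p₂, y₂) →
    (τ₁ <+: τ₂ ∨ τ₂ <+: τ₁) → p₁ <+: p₂ → p₁ = p₂ ∧ y₁ = y₂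

/-- `M.Computes A p y` : with oracle `A`, machine `M` halts on program `p` with
output `y`. -/
def PrefixOracleMachine.Computes (M : PrefixOracleMachine) (A : Seq2) (p y : BinStr) : Prop :=
  ∃ s τ, M.axioms s = some (τ, p, y) ∧ ∃ n, τ = restrict A n

/-- A universal prefix-free oracle machine: it describes every string (relative
to every oracle), and it simulates every prefix-free oracle machine up to an
additive constant in the length of programs. -/
structure UniversalPrefixMachine extends PrefixOracleMachine where
  total : ∀ (A : Seq2) (y : BinStr), ∃ p, toPrefixOracleMachine.Computes A p y
  universal : ∀ M : PrefixOracleMachine, ∃ c : ℕ, ∀ (A : Seq2) (p y : BinStr),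
    M.Computes A p y →
      ∃ q, toPrefixOracleMachine.Computes A q y ∧ q.length ≤ p.length + c

/-- `K^A(y)` : prefix-free Kolmogorov complexity of `y` relative to oracle `A`. -/
noncomputable def KOr (U : UniversalPrefixMachine) (A : Seq2) (y : BinStr) : ℕ :=
  sInf {n | ∃ p : BinStr, p.length = n ∧ U.toPrefixOracleMachine.Computes A p y}

/-- The all-zeros (recursive) oracle. -/
def zeroSeq : Seq2 := fun _ => false

/-- `K(y)` : (unrelativized) prefix-free Kolmogorov complexity. -/
noncomputable def Kc (U : UniversalPrefixMachine) (y : BinStr) : ℕ := KOr U zeroSeq y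

/-- `K(n)` : the complexity of the string of `n` zeros. -/
noncomputable def KcNat (U : UniversalPrefixMachine) (n : ℕ) : ℕ :=
  Kc U (List.replicate n false)

/-- `A ∈ KT(g)` : `A` is K-trivial up to `g`. -/
def KT (U : UniversalPrefixMachine) (g : ℕ → ℕ) (A : Seq2) : Prop :=
  ∃ c : ℕ, ∀ n : ℕ, Kc U (restrict A n) ≤ KcNat U n + g n + c

/-- `A ∈ LK(f)` : `A` is low for K up to `f`. -/
def LK (U : UniversalPrefixMachine) (f : BinStr → ℕ) (A : Seq2) : Prop :=
  ∃ c : ℕ, ∀ σ : BinStr, Kc U σ ≤ KOr U A σ + f σ + c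

/-- The position of a string in the length-lexicographic ordering of `2^{<ω}`. -/
def strNum (σ : BinStr) : ℕ := σ.foldl (fun n b => 2 * n + (if b then 2 else 1)) 0

/-- A function `ℕ → ℕ` is Δ⁰₂ iff it has a recursive approximation. -/
def Delta02Fun (g : ℕ → ℕ) : Prop :=
  ∃ G : ℕ → ℕ → ℕ, Computable₂ G ∧ ∀ x, ∃ t, ∀ s ≥ t, G s x = g x

/-- A function `2^{<ω} → ℕ` is Δ⁰₂ iff it has a recursive approximation. -/
def Delta02StrFun (f : BinStr → ℕ) : Prop :=
  ∃ F : ℕ → BinStr → ℕ, Computable₂ F ∧ ∀ σ, ∃ t, ∀ s ≥ t, F s σ = f σ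

/-- A real is Δ⁰₂ iff it has a recursive approximation. -/
def Delta02Seq (A : Seq2) : Prop :=
  ∃ F : ℕ → ℕ → Bool, Computable₂ F ∧ ∀ x, ∃ t, ∀ s ≥ t, F s x = A x

/-- An order: an unbounded nondecreasing function `ℕ → ℕ`. -/
def IsOrder (g : ℕ → ℕ) : Prop := Monotone g ∧ ∀ b : ℕ, ∃ m, b < g m

/-- An order on strings: unbounded and nondecreasing with respect to the
length-lexicographic ordering of `2^{<ω}`. -/
def IsStrOrder (f : BinStr → ℕ) : Prop :=
  (∀ σ τ : BinStr, strNum σ ≤ strNum τ → f σ ≤ f τ) ∧ ∀ b : ℕ, ∃ σ, b < f σ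

/-- `A ∈ KT(Δ⁰₂)` : `A` is K-trivial up to every Δ⁰₂ order. -/
def KTDelta (U : UniversalPrefixMachine) (A : Seq2) : Prop :=
  ∀ g : ℕ → ℕ, Delta02Fun g → IsOrder g → KT U g A

/-- `A ∈ LK(Δ⁰₂)` : `A` is low for K up to every Δ⁰₂ order. -/
def LKDelta (U : UniversalPrefixMachine) (A : Seq2) : Prop :=
  ∀ f : BinStr → ℕ, Delta02StrFun f → IsStrOrder f → LK U f A

/-- A Δ⁰₂ function is finite-to-one approximable if it has a recursive
approximation `F` such that for every `n`, for all but finitely many `m`,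
`F s m > n` for all stages `s`. -/
def FinToOneApprox (f : ℕ → ℕ) : Prop :=
  ∃ F : ℕ → ℕ → ℕ, Computable₂ F ∧ (∀ x, ∃ t, ∀ s ≥ t, F s x = f x) ∧
    ∀ n : ℕ, {m : ℕ | ∃ s, F s m ≤ n}.Finite

/-- A Turing functional, presented as a computable enumeration of axioms
`(τ, n, b)`, meaning: on any oracle extending `τ`, the output bit `n` is `b`. -/
structure TuringFunctional where
  axioms : ℕ → Option (BinStr × ℕ × Bool)
  axioms_computable : Computable axioms
  consistent : ∀ s t τ₁ n₁ b₁ τ₂ n₂ b₂,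
    axioms s = some (τ₁, n₁, b₁) → axioms t = some (τ₂, n₂, b₂) →
    (τ₁ <+: τ₂ ∨ τ₂ <+: τ₁) → n₁ = n₂ → b₁ = b₂

/-- `Φ.Computes B A` : `Φ^B = A`. -/
def TuringFunctional.Computes (Φ : TuringFunctional) (B A : Seq2) : Prop :=
  ∀ n : ℕ, ∃ s k, Φ.axioms s = some (restrict B k, n, A n)

/-- Turing reducibility `A ≤_T B`. -/
def TuringLE (A B : Seq2) : Prop := ∃ Φ : TuringFunctional, Φ.Computes B A

/-- Weak truth-table reducibility `A ≤_wtt B` : a Turing reduction whose use is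
bounded by a recursive function. -/
def WttLE (A B : Seq2) : Prop :=
  ∃ (Φ : TuringFunctional) (u : ℕ → ℕ), Computable u ∧
    ∀ n : ℕ, ∃ s k, k ≤ u n ∧ Φ.axioms s = some (restrict B k, n, A n)

/-- The effective join `A ⊕ B`. -/
def join (A B : Seq2) : Seq2 := fun n => if n % 2 = 0 then A (n / 2) else B (n / 2)

/-- `A` is Martin-Löf random: `K(A↾n) ≥ n - c` for all `n`. -/
def MLRandom (U : UniversalPrefixMachine) (A : Seq2) : Prop :=
  ∃ c : ℕ, ∀ n : ℕ, n ≤ Kc U (restrict A n) + c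

/-- `A` is infinitely often K-trivial. -/
def InfOftenKTrivial (U : UniversalPrefixMachine) (A : Seq2) : Prop :=
  ∃ c : ℕ, {n : ℕ | Kc U (restrict A n) ≤ KcNat U n + c}.Infinite

/-- K-reducibility `B ≤_K A`. -/
def KLE (U : UniversalPrefixMachine) (B A : Seq2) : Prop :=
  ∃ c : ℕ, ∀ n : ℕ, Kc U (restrict B n) ≤ Kc U (restrict A n) + c

/-- LK-reducibility `A ≤_LK B`. -/
def LKLE (U : UniversalPrefixMachine) (A B : Seq2) : Prop :=
  ∃ c : ℕ, ∀ σ : BinStr, KOr U B σ ≤ KOr U A σ + c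

/-- `A` is weakly low for K: `K(σ) ≤ K^A(σ) + c` for infinitely many strings σ. -/
def WeaklyLowForK (U : UniversalPrefixMachine) (A : Seq2) : Prop :=
  ∃ c : ℕ, {σ : BinStr | Kc U σ ≤ KOr U A σ + c}.Infinite

/-- Chaitin's Ω : the measure of the domain of the universal machine. -/
noncomputable def Omega (U : UniversalPrefixMachine) : ℝ :=
  ∑' p : {p : BinStr // ∃ y, U.toPrefixOracleMachine.Computes zeroSeq p y},
    ((2 : ℝ) ^ (p : BinStr).length)⁻¹

/-- The `n`-th binary digit of a real number `x`. -/
noncomputable def realBit (x : ℝ) (n : ℕ) : Bool :=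
  decide (⌊x * 2 ^ (n + 1)⌋ % 2 = 1)

/-- `Ω↾n` : the length-`n` initial segment of the binary expansion of Ω. -/
noncomputable def omegaStr (U : UniversalPrefixMachine) (n : ℕ) : BinStr :=
  (List.range n).map (realBit (Omega U))

/-- `A` is low for Ω. -/
def LowForOmega (U : UniversalPrefixMachine) (A : Seq2) : Prop :=
  ∀ c : ℕ, ∃ n : ℕ, KOr U A (omegaStr U n) + c < n

/-- The uniform (coin-flipping) measure on `2^ω`, obtained as the image of
Lebesgue measure on `[0,1]` under the binary-expansion map. -/
noncomputable def cantorMeasure : MeasureTheory.Measure Seq2 :=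
  MeasureTheory.Measure.map (fun x : ℝ => fun n : ℕ => realBit x n)
    (MeasureTheory.volume.restrict (Set.Icc (0 : ℝ) 1))

/-! ### Compressing relative to the zero oracle and transferring oracles -/

/-- A self-delimiting code for finite binary strings. -/
def selfDelim : BinStr → BinStr
  | [] => [false]
  | b :: l => true :: b :: selfDelim l

theorem selfDelim_length (u : BinStr) : (selfDelim u).length = 2 * u.length + 1 := by
  induction u with
  | nil => rfl
  | cons b l ih => simp only [selfDelim, List.length_cons, ih]; ring

theorem selfDelim_append_prefix {u v r t : BinStr} (h : selfDelim u ++ r <+: selfDelim v ++ t) :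
    u = v ∧ r <+: t := by
  induction u generalizing v with
  | nil => cases v <;> simp_all [selfDelim]
  | cons b l ih =>
    cases v with
    | nil => simp [selfDelim] at h
    | cons b' l' =>
      simp only [selfDelim, List.cons_append, List.cons_prefix_cons, true_and] at h
      obtain ⟨rfl, h⟩ := h
      obtain ⟨rfl, h'⟩ := ih h
      exact ⟨rfl, h'⟩

theorem primrec_selfDelim : Primrec selfDelim := by
  have h : Primrec fun u : BinStr =>
      u.foldr (fun b acc => true :: b :: acc) [false] :=
    Primrec.list_foldr Primrec.id (Primrec.const _)
      (Primrec.list_cons.comp (Primrec.const true)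
        (Primrec.list_cons.comp (Primrec.fst.comp Primrec.snd)
          (Primrec.snd.comp Primrec.snd))).to₂
  refine h.of_eq fun u => ?_
  induction u with
  | nil => rfl
  | cons b l ih => rw [List.foldr_cons, ih]; rfl

theorem restrict_length (A : Seq2) (n : ℕ) : (restrict A n).length = n := by simp [restrict]

theorem restrict_succ (A : Seq2) (n : ℕ) : restrict A (n + 1) = restrict A n ++ [A n] := by
  simp [restrict, List.range_succ]

theorem restrict_getD (A : Seq2) {m n : ℕ} (h : m < n) (d : Bool) :
    (restrict A n).getD m d = A m := by
  simp [restrict, List.getD_eq_getElem?_getD, h]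

theorem exists_computes_length_eq_KOr (U : UniversalPrefixMachine) (A : Seq2) (y : BinStr) :
    ∃ p : BinStr, p.length = KOr U A y ∧ U.toPrefixOracleMachine.Computes A p y :=
  Nat.sInf_mem (s := {n | ∃ p : BinStr, p.length = n ∧ U.toPrefixOracleMachine.Computes A p y})
    (let ⟨p, hp⟩ := U.total A y; ⟨p.length, p, rfl, hp⟩)

theorem exists_KOr_le_length (U : UniversalPrefixMachine) (M : PrefixOracleMachine) :
    ∃ c : ℕ, ∀ (A : Seq2) (p y : BinStr), M.Computes A p y → KOr U A y ≤ p.length + c := by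
  obtain ⟨c, hc⟩ := U.universal M
  refine ⟨c, fun A p y h => ?_⟩
  obtain ⟨q, hq, hl⟩ := hc A p y h
  have hle : KOr U A y ≤ q.length := Nat.sInf_le ⟨q, rfl, hq⟩
  exact hle.trans hl

/-- The machine which reads a program of `M` for a string `y` followed by self-delimiting codes of
two strings `u` and `v`, and outputs `D (|y|, u, v)`. -/
def sideInfoMachine (M : PrefixOracleMachine) (D : ℕ × BinStr × BinStr → BinStr)
    (hD : Computable D) : PrefixOracleMachine where
  axioms s := (Encodable.decode (α := ℕ × BinStr × BinStr) s).bind fun a =>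
    (M.axioms a.1).map fun t =>
      (t.1, t.2.1 ++ (selfDelim a.2.1 ++ selfDelim a.2.2), D (t.2.2.length, a.2.1, a.2.2))
  axioms_computable := by
    refine Computable.option_bind Computable.decode ?_
    refine Computable.option_map
      (M.axioms_computable.comp (Computable.fst.comp Computable.snd)) ?_
    have hu : Computable fun p : (ℕ × ℕ × BinStr × BinStr) × (BinStr × BinStr × BinStr) =>
        p.1.2.2.1 :=
      Computable.fst.comp (Computable.snd.comp (Computable.snd.comp Computable.fst))
    have hv : Computable fun p : (ℕ × ℕ × BinStr × BinStr) × (BinStr × BinStr × BinStr) =>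
        p.1.2.2.2 :=
      Computable.snd.comp (Computable.snd.comp (Computable.snd.comp Computable.fst))
    refine Computable.pair (Computable.fst.comp Computable.snd) (Computable.pair ?_ ?_)
    · exact Computable.list_append.comp (Computable.fst.comp (Computable.snd.comp Computable.snd))
        (Computable.list_append.comp (primrec_selfDelim.to_comp.comp hu)
          (primrec_selfDelim.to_comp.comp hv))
    · exact hD.comp (Computable.pair (Computable.list_length.comp
        (Computable.snd.comp (Computable.snd.comp Computable.snd))) (Computable.pair hu hv))
  consistent := by
    intro s t τ₁ p₁ y₁ τ₂ p₂ y₂ h₁ h₂ hτ hp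
    simp only [Option.bind_eq_some_iff, Option.map_eq_some_iff, Prod.mk.injEq] at h₁ h₂
    obtain ⟨⟨s', u₁, v₁⟩, -, ⟨σ₁, q₁, z₁⟩, ha₁, rfl, rfl, rfl⟩ := h₁
    obtain ⟨⟨t', u₂, v₂⟩, -, ⟨σ₂, q₂, z₂⟩, ha₂, rfl, rfl, rfl⟩ := h₂
    dsimp only at *
    have hq : q₁ = q₂ ∧ z₁ = z₂ := by
      rcases List.prefix_or_prefix_of_prefix ((List.prefix_append _ _).trans hp)
        (List.prefix_append q₂ _) with h | h
      · exact M.consistent _ _ _ _ _ _ _ _ ha₁ ha₂ hτ h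
      · obtain ⟨h, h'⟩ := M.consistent _ _ _ _ _ _ _ _ ha₂ ha₁ hτ.symm h
        exact ⟨h.symm, h'.symm⟩
    obtain ⟨rfl, rfl⟩ := hq
    obtain ⟨rfl, hv⟩ := selfDelim_append_prefix ((List.prefix_append_right_inj _).1 hp)
    obtain ⟨rfl, -⟩ := selfDelim_append_prefix (r := []) (t := []) (by simpa using hv)
    exact ⟨rfl, rfl⟩

theorem exists_Kc_le_KcNat_add_length (U : UniversalPrefixMachine)
    (D : ℕ × BinStr × BinStr → BinStr) (hD : Computable D) :
    ∃ c : ℕ, ∀ n u v, Kc U (D (n, u, v)) ≤ KcNat U n + (2 * u.length + 2 * v.length) + c := by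
  obtain ⟨c, hc⟩ := exists_KOr_le_length U (sideInfoMachine U.toPrefixOracleMachine D hD)
  refine ⟨c + 2, fun n u v => ?_⟩
  obtain ⟨q, hq, s, τ, hs, hτ⟩ := exists_computes_length_eq_KOr U zeroSeq (List.replicate n false)
  have h := hc zeroSeq (q ++ (selfDelim u ++ selfDelim v)) (D (n, u, v))
    ⟨Encodable.encode (s, u, v), τ, by simp [sideInfoMachine, hs], hτ⟩
  simp only [List.length_append, selfDelim_length, hq] at h
  change Kc U (D (n, u, v)) ≤ KcNat U n + _ + c at h
  omega

/-- One step of `decodeMarked`: copy the bit following each marker `true`. -/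
def decodeStep (st : Bool × BinStr) (b : Bool) : Bool × BinStr :=
  if st.1 then (false, st.2 ++ [b]) else (b, st.2)

/-- Extract the bits that follow the markers of a string. -/
def decodeMarked (ρ : BinStr) : BinStr := (ρ.foldl decodeStep (false, [])).2

theorem primrec_decodeMarked : Primrec decodeMarked := by
  refine Primrec.snd.comp (Primrec.list_foldl (h := fun _ p => decodeStep p.1 p.2) Primrec.id
    (Primrec.const _) ?_)
  have hst : Primrec fun p : BinStr × ((Bool × BinStr) × Bool) => p.2.1 :=
    Primrec.fst.comp Primrec.snd
  have hb : Primrec fun p : BinStr × ((Bool × BinStr) × Bool) => p.2.2 :=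
    Primrec.snd.comp Primrec.snd
  refine (Primrec.cond (Primrec.fst.comp hst)
    (Primrec.pair (Primrec.const false) (Primrec.list_concat.comp (Primrec.snd.comp hst) hb))
    (Primrec.pair hb (Primrec.snd.comp hst))).of_eq fun p => ?_
  rcases p with ⟨_, ⟨_ | _, _⟩, _⟩ <;> rfl

theorem prefix_foldl_decodeStep (ρ : BinStr) (st : Bool × BinStr) :
    st.2 <+: (ρ.foldl decodeStep st).2 := by
  induction ρ generalizing st with
  | nil => exact List.prefix_rfl
  | cons b l ih =>
    refine List.IsPrefix.trans ?_ (ih _)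
    unfold decodeStep
    split <;> simp

theorem decodeMarked_prefix {ρ₁ ρ₂ : BinStr} (h : ρ₁ <+: ρ₂) :
    decodeMarked ρ₁ <+: decodeMarked ρ₂ := by
  obtain ⟨r, rfl⟩ := h
  rw [decodeMarked, decodeMarked, List.foldl_append]
  exact prefix_foldl_decodeStep _ _

/-- The machine which, on an oracle string `ρ`, simulates `M` on the string `decodeMarked ρ`. -/
def decodedOracleMachine (M : PrefixOracleMachine) : PrefixOracleMachine where
  axioms s := (Encodable.decode (α := ℕ × BinStr) s).bind fun a =>
    (M.axioms a.1).bind fun t =>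
      bif decide (t.1 = decodeMarked a.2) then some (a.2, t.2) else none
  axioms_computable := by
    refine Computable.option_bind Computable.decode ?_
    refine Computable.option_bind (β := BinStr × BinStr × BinStr)
      (M.axioms_computable.comp (Computable.fst.comp Computable.snd)) ?_
    have hρ : Computable fun p : (ℕ × ℕ × BinStr) × (BinStr × BinStr × BinStr) => p.1.2.2 :=
      Computable.snd.comp (Computable.snd.comp Computable.fst)
    have hc : Computable fun p : (ℕ × ℕ × BinStr) × (BinStr × BinStr × BinStr) =>
        decide (p.2.1 = decodeMarked p.1.2.2) :=
      Primrec.eq.decide.to_comp.comp (Computable.fst.comp Computable.snd)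
        (primrec_decodeMarked.to_comp.comp hρ)
    exact Computable.cond hc (Computable.option_some.comp
      (Computable.pair hρ (Computable.snd.comp Computable.snd))) (Computable.const none)
  consistent := by
    intro s t τ₁ p₁ y₁ τ₂ p₂ y₂ h₁ h₂ hτ hp
    simp only [Option.bind_eq_some_iff] at h₁ h₂
    obtain ⟨⟨s', ρ₁⟩, -, ⟨σ₁, q₁⟩, ha₁, h₁⟩ := h₁
    obtain ⟨⟨t', ρ₂⟩, -, ⟨σ₂, q₂⟩, ha₂, h₂⟩ := h₂
    dsimp only at ha₁ ha₂ h₁ h₂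
    rw [Bool.cond_eq_ite, Option.ite_none_right_eq_some] at h₁ h₂
    obtain ⟨e₁, h₁⟩ := h₁
    obtain ⟨e₂, h₂⟩ := h₂
    simp only [decide_eq_true_iff, Option.some.injEq, Prod.mk.injEq] at e₁ e₂ h₁ h₂
    obtain ⟨rfl, rfl⟩ := h₁
    obtain ⟨rfl, rfl⟩ := h₂
    subst e₁ e₂
    exact M.consistent _ _ _ _ _ _ _ _ ha₁ ha₂
      (hτ.imp decodeMarked_prefix decodeMarked_prefix) hp

theorem exists_KOr_le_of_decodeMarked (U : UniversalPrefixMachine) {A B : Seq2}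
    (h : ∀ n, ∃ m, decodeMarked (restrict A m) = restrict B n) :
    ∃ c : ℕ, ∀ y, KOr U A y ≤ KOr U B y + c := by
  obtain ⟨c, hc⟩ := exists_KOr_le_length U (decodedOracleMachine U.toPrefixOracleMachine)
  refine ⟨c, fun y => ?_⟩
  obtain ⟨q, hq, s, _, hs, n, rfl⟩ := exists_computes_length_eq_KOr U B y
  obtain ⟨m, hm⟩ := h n
  rw [← hq]
  exact hc A q y ⟨Encodable.encode (s, restrict A m), restrict A m,
    by simp [decodedOracleMachine, hs, hm], m, rfl⟩

/-! ### A self-approximating sequence dominating every `Δ⁰₂` function -/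

/-- At stage `s = ⟨t, w⟩`, the program coded in `i` is first seen (with fuel `w + 1`) to output `1`
on input `⟨i, t⟩`. -/
def firstHalt (i s : ℕ) : Bool :=
  decide (Nat.Partrec.Code.evaln (s.unpair.2 + 1) (Denumerable.ofNat Nat.Partrec.Code i.unpair.1)
    (Nat.pair i s.unpair.1) = some 1) &&
  !decide (Nat.Partrec.Code.evaln s.unpair.2 (Denumerable.ofNat Nat.Partrec.Code i.unpair.1)
    (Nat.pair i s.unpair.1) = some 1)

theorem primrec_firstHalt : Primrec₂ firstHalt := by
  have hc : Primrec fun p : ℕ × ℕ => Denumerable.ofNat Nat.Partrec.Code p.1.unpair.1 :=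
    (Primrec.ofNat _).comp (Primrec.fst.comp (Primrec.unpair.comp Primrec.fst))
  have ht : Primrec fun p : ℕ × ℕ => Nat.pair p.1 p.2.unpair.1 :=
    Primrec₂.natPair.comp Primrec.fst (Primrec.fst.comp (Primrec.unpair.comp Primrec.snd))
  have hw : Primrec fun p : ℕ × ℕ => p.2.unpair.2 :=
    Primrec.snd.comp (Primrec.unpair.comp Primrec.snd)
  have key : ∀ g : ℕ × ℕ → ℕ, Primrec g → Primrec fun p : ℕ × ℕ =>
      decide (Nat.Partrec.Code.evaln (g p) (Denumerable.ofNat Nat.Partrec.Code p.1.unpair.1)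
        (Nat.pair p.1 p.2.unpair.1) = some 1) := fun g hg =>
    (Primrec.beq.comp (Nat.Partrec.Code.primrec_evaln.comp ((hg.pair hc).pair ht))
      (Primrec.const (some 1))).of_eq fun p => rfl
  exact Primrec.and.comp (key _ (Primrec.succ.comp hw)) (Primrec.not.comp (key _ hw))

/-- Some index `i < k` selected by `a` has an event at stage `s`. -/
def eventAt (a : ℕ → Bool) (k s : ℕ) : Bool :=
  (List.range k).any fun i => a i && firstHalt i s

/-- One more than the last stage below `n` with an event for an index `i < k` selected by `a`,
or `0` if there is none. -/
def lastEvent (a : ℕ → Bool) (k : ℕ) : ℕ → ℕ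
  | 0 => 0
  | n + 1 => bif eventAt a k n then n + 1 else lastEvent a k n

theorem eventAt_iff {a : ℕ → Bool} {k s : ℕ} :
    eventAt a k s = true ↔ ∃ i < k, a i = true ∧ firstHalt i s = true := by
  simp [eventAt]

theorem eventAt_congr {a b : ℕ → Bool} {k : ℕ} (h : ∀ i < k, a i = b i) :
    eventAt a k = eventAt b k := by
  funext s
  rw [Bool.eq_iff_iff, eventAt_iff, eventAt_iff]
  refine exists_congr fun i => and_congr_right fun hi => by rw [h i hi]

theorem lastEvent_congr {a b : ℕ → Bool} {k : ℕ} (h : ∀ i < k, a i = b i) (n : ℕ) :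
    lastEvent a k n = lastEvent b k n := by
  induction n with
  | zero => rfl
  | succ n ih => rw [lastEvent, lastEvent, ih, eventAt_congr h]

theorem lastEvent_le (a : ℕ → Bool) (k n : ℕ) : lastEvent a k n ≤ n := by
  induction n with
  | zero => exact le_rfl
  | succ n ih =>
    rw [lastEvent]
    cases eventAt a k n
    · exact ih.trans n.le_succ
    · exact le_rfl

theorem lt_lastEvent {a : ℕ → Bool} {k n s : ℕ} (hs : s < n) (h : eventAt a k s = true) :
    s < lastEvent a k n := by
  induction n with
  | zero => omega
  | succ n ih =>
    rw [lastEvent]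
    rcases Nat.lt_succ_iff_lt_or_eq.1 hs with hs | rfl
    · cases eventAt a k n
      · exact ih hs
      · exact hs.trans n.lt_succ_self
    · simp [h]

theorem lastEvent_mono_index (a : ℕ → Bool) {k l : ℕ} (h : k ≤ l) (n : ℕ) :
    lastEvent a k n ≤ lastEvent a l n := by
  induction n with
  | zero => exact le_rfl
  | succ n ih =>
    rw [lastEvent]
    cases hk : eventAt a k n
    · refine ih.trans ?_
      rw [lastEvent]
      cases eventAt a l n
      · exact le_rfl
      · exact (lastEvent_le a l n).trans n.le_succ
    · obtain ⟨i, hi, h'⟩ := eventAt_iff.1 hk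
      exact lt_lastEvent n.lt_succ_self (eventAt_iff.2 ⟨i, hi.trans_le h, h'⟩)

theorem lastEvent_eq_of_le {a : ℕ → Bool} {k m n : ℕ} (hmn : m ≤ n)
    (h : ∀ s, m ≤ s → s < n → eventAt a k s = false) : lastEvent a k n = lastEvent a k m := by
  induction n, hmn using Nat.le_induction with
  | base => rfl
  | succ n hmn ih =>
    rw [lastEvent, h n hmn n.lt_succ_self, cond_false]
    exact ih fun s hs hs' => h s hs (hs'.trans n.lt_succ_self)

theorem lastEvent_eq_of_lastEvent_le {a : ℕ → Bool} {k m n : ℕ} (hmn : m ≤ n)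
    (h : lastEvent a k n ≤ m) : lastEvent a k m = lastEvent a k n := by
  refine (lastEvent_eq_of_le hmn fun s hs hs' => ?_).symm
  by_contra h'
  exact absurd (lt_lastEvent hs' (Bool.eq_true_of_not_eq_false h')) (by omega)

/-- The indices with only finitely many events. -/
noncomputable def finitelyActive (i : ℕ) : Bool :=
  open Classical in decide (∃ N, ∀ s ≥ N, firstHalt i s = false)

theorem finitelyActive_eq_true {i : ℕ} :
    finitelyActive i = true ↔ ∃ N, ∀ s ≥ N, firstHalt i s = false := by
  simp [finitelyActive]

theorem exists_eventAt_eq_false (k : ℕ) :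
    ∃ N, ∀ s ≥ N, eventAt finitelyActive k s = false := by
  induction k with
  | zero => exact ⟨0, fun s _ => rfl⟩
  | succ k ih =>
    obtain ⟨N, hN⟩ := ih
    by_cases hk : ∃ N, ∀ s ≥ N, firstHalt k s = false
    · obtain ⟨N', hN'⟩ := hk
      refine ⟨max N N', fun s hs => ?_⟩
      have h := hN s (le_trans (le_max_left _ _) hs)
      have h' := hN' s (le_trans (le_max_right _ _) hs)
      rw [eventAt] at h ⊢
      rw [List.range_succ, List.any_append, h]
      simp [h']
    · refine ⟨N, fun s hs => ?_⟩
      have h := hN s hs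
      have h' : finitelyActive k = false :=
        Bool.eq_false_of_not_eq_true (mt finitelyActive_eq_true.1 hk)
      rw [eventAt] at h ⊢
      rw [List.range_succ, List.any_append, h]
      simp [h']

/-- The limit of `lastEvent finitelyActive k n` as `n` grows. -/
noncomputable def settleTime (k : ℕ) : ℕ :=
  lastEvent finitelyActive k (exists_eventAt_eq_false k).choose

theorem lastEvent_eq_settleTime_of_large {k n : ℕ}
    (h : (exists_eventAt_eq_false k).choose ≤ n) :
    lastEvent finitelyActive k n = settleTime k :=
  lastEvent_eq_of_le h fun s hs _ => (exists_eventAt_eq_false k).choose_spec s hs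

theorem lastEvent_eq_settleTime {k n : ℕ} (h : settleTime k ≤ n) :
    lastEvent finitelyActive k n = settleTime k := by
  rcases le_total (exists_eventAt_eq_false k).choose n with h' | h'
  · exact lastEvent_eq_settleTime_of_large h'
  · exact lastEvent_eq_of_lastEvent_le h' h

theorem settleTime_mono : Monotone settleTime := fun k l h => by
  rw [← lastEvent_eq_settleTime_of_large (le_max_left _ (exists_eventAt_eq_false l).choose),
    ← lastEvent_eq_settleTime_of_large (le_max_right (exists_eventAt_eq_false k).choose _)]
  exact lastEvent_mono_index _ h _

theorem lt_settleTime {i k s : ℕ} (hi : i < k) (ha : finitelyActive i = true)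
    (h : firstHalt i s = true) : s < settleTime k := by
  rw [← lastEvent_eq_settleTime_of_large (le_max_left _ (s + 1))]
  exact lt_lastEvent (lt_of_lt_of_le s.lt_succ_self (le_max_right _ _))
    (eventAt_iff.2 ⟨i, hi, ha, h⟩)

theorem exists_code_bounding_settleTime (R : ℕ → ℕ → Bool) (hR : Computable₂ R)
    (hfin : ∀ i, ∃ T, ∀ t ≥ T, R i t = false) :
    ∃ c : ℕ, ∀ k n t, Nat.pair c k < n → R (Nat.pair c k) t = true → t < settleTime n := by
  have hf : Computable fun m : ℕ => (R m.unpair.1 m.unpair.2).toNat :=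
    (Primrec.dom_bool Bool.toNat).to_comp.comp
      (hR.comp (Computable.fst.comp Computable.unpair) (Computable.snd.comp Computable.unpair))
  obtain ⟨code, hcode⟩ := Nat.Partrec.Code.exists_code.1 (Partrec.nat_iff.1 hf.partrec)
  refine ⟨Encodable.encode code, fun k n t hn ht => ?_⟩
  set i := Nat.pair (Encodable.encode code) k with hi
  have hic : Denumerable.ofNat Nat.Partrec.Code i.unpair.1 = code := by simp [hi]
  have hval : ∀ t, 1 ∈ code.eval (Nat.pair i t) ↔ R i t = true := fun t => by
    rw [hcode]; cases h : R i t <;> simp [h]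
  have hact : finitelyActive i = true := by
    obtain ⟨T, hT⟩ := hfin i
    have hlt : ∀ s, firstHalt i s = true → s.unpair.1 < T := fun s hs => by
      rw [firstHalt, hic, Bool.and_eq_true, decide_eq_true_iff] at hs
      by_contra h
      have := (hval _).1 (Nat.Partrec.Code.evaln_sound (Option.mem_def.2 hs.1))
      rw [hT _ (not_lt.1 h)] at this
      exact Bool.false_ne_true this
    have hinj : Set.InjOn (fun s : ℕ => s.unpair.1) {s | firstHalt i s = true} := by
      have hle : ∀ s s', firstHalt i s = true → firstHalt i s' = true →
          s.unpair.1 = s'.unpair.1 → s'.unpair.2 ≤ s.unpair.2 := fun s s' h h' e => by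
        rw [firstHalt, Bool.and_eq_true, decide_eq_true_iff] at h h'
        by_contra hlt
        have := Nat.Partrec.Code.evaln_mono (not_le.1 hlt) (Option.mem_def.2 h.1)
        rw [e] at this
        simp [Option.mem_def.1 this] at h'
      intro s hs s' hs' e
      rw [← Nat.pair_unpair s, ← Nat.pair_unpair s']
      exact congrArg₂ Nat.pair e (le_antisymm (hle s' s hs' hs e.symm) (hle s s' hs hs' e))
    have hsfin : {s | firstHalt i s = true}.Finite :=
      Set.Finite.of_injOn (t := Set.Iio T) (fun s hs => hlt s hs) hinj (Set.finite_Iio T)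
    obtain ⟨N, hN⟩ := hsfin.bddAbove
    refine finitelyActive_eq_true.2 ⟨N + 1, fun s hs => ?_⟩
    by_contra h
    exact absurd (hN (Bool.eq_true_of_not_eq_false h)) (by omega)
  obtain ⟨w, hw, hmin⟩ : ∃ w, Nat.Partrec.Code.evaln (w + 1) code (Nat.pair i t) = some 1 ∧
      Nat.Partrec.Code.evaln w code (Nat.pair i t) ≠ some 1 := by
    have hex := Nat.Partrec.Code.evaln_complete.1 ((hval t).2 ht)
    classical
    have h0 := Nat.find_spec hex
    have hm := fun m (hm : m < Nat.find hex) => Nat.find_min hex hm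
    cases hF : Nat.find hex with
    | zero => rw [hF] at h0; simp [Nat.Partrec.Code.evaln] at h0
    | succ w =>
      rw [hF] at h0 hm
      exact ⟨w, h0, hm w w.lt_succ_self⟩
  have hev : firstHalt i (Nat.pair t w) = true := by
    simp [firstHalt, hic, hw, hmin]
  exact (Nat.left_le_pair t w).trans_lt (lt_settleTime hn hact hev)

/-- Scan for the first `x < m` with `q ≤ h x`, returning `m` if there is none. -/
def scanFirst (h : ℕ → ℕ) (q : ℕ) : ℕ → ℕ
  | 0 => 0
  | m + 1 => bif decide (q ≤ h (scanFirst h q m)) then scanFirst h q m else scanFirst h q m + 1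

theorem scanFirst_le (h : ℕ → ℕ) (q m : ℕ) : scanFirst h q m ≤ m := by
  induction m with
  | zero => exact le_rfl
  | succ m ih => rw [scanFirst]; cases decide (q ≤ h (scanFirst h q m)) <;> simp <;> omega

theorem scanFirst_eq_min {h : ℕ → ℕ} {q x : ℕ} (hx : q ≤ h x) (hlt : ∀ y < x, h y < q) (m : ℕ) :
    scanFirst h q m = min m x := by
  induction m with
  | zero => simp [scanFirst]
  | succ m ih =>
    rw [scanFirst, ih]
    rcases lt_or_ge m x with h' | h'
    · rw [min_eq_left h'.le, min_eq_left h', decide_eq_false (not_le.2 (hlt m h')), cond_false]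
    · rw [min_eq_right h', min_eq_right (h'.trans m.le_succ), decide_eq_true hx, cond_true]

theorem computable_scanFirst {G : ℕ → ℕ → ℕ} (hG : Computable₂ G) {q : ℕ → ℕ}
    (hq : Computable q) : Computable₂ fun i s => scanFirst (G s) (q i) s := by
  have hs : Computable fun p : (ℕ × ℕ) × (ℕ × ℕ) => p.2.2 := Computable.snd.comp Computable.snd
  have hcond : Computable fun p : (ℕ × ℕ) × (ℕ × ℕ) => decide (q p.1.1 ≤ G p.1.2 p.2.2) :=
    Primrec.nat_le.decide.to_comp.comp (hq.comp (Computable.fst.comp Computable.fst))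
      (hG.comp (Computable.snd.comp Computable.fst) hs)
  refine (Computable.nat_rec (f := fun p : ℕ × ℕ => p.2) (g := fun _ => 0)
    Computable.snd (Computable.const 0)
    (Computable.cond hcond hs (Computable.succ.comp hs)).to₂).of_eq fun p => ?_
  generalize hm : p.2 = m
  have : ∀ m, Nat.rec (motive := fun _ => ℕ) 0 (fun _ a =>
      bif decide (q p.1 ≤ G p.2 a) then a else a + 1) m = scanFirst (G p.2) (q p.1) m := by
    intro m
    induction m with
    | zero => rfl
    | succ m ih => rw [scanFirst, ← ih]
  rw [← hm]
  exact this p.2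

/-- For every `Δ⁰₂` order `g` and computable `q`, the values of `g` past `settleTime` are large. -/
theorem exists_le_order_of_settleTime_le {g : ℕ → ℕ} (hg : Delta02Fun g) (ho : IsOrder g)
    {q : ℕ → ℕ} (hq : Computable q) :
    ∃ c : ℕ, ∀ k n x, Nat.pair c k < n → settleTime n ≤ x → q (Nat.pair c k) ≤ g x := by
  obtain ⟨G, hG, hlim⟩ := hg
  set F : ℕ → ℕ → ℕ := fun i s => scanFirst (G s) (q i) s with hF
  have hFc : Computable₂ F := computable_scanFirst hG hq
  have hFlim : ∀ i, ∃ x T, q i ≤ g x ∧ ∀ s ≥ T, F i s = x := by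
    intro i
    have hex : ∃ x, q i ≤ g x := (ho.2 (q i)).imp fun _ => le_of_lt
    classical
    choose t ht using hlim
    refine ⟨Nat.find hex, (Finset.range (Nat.find hex + 1)).sup t + Nat.find hex,
      Nat.find_spec hex, fun s hs => ?_⟩
    have hle : ∀ y ≤ Nat.find hex, G s y = g y := fun y hy => ht y s <|
      le_trans (Finset.le_sup (f := t) (Finset.mem_range.2 (Nat.lt_add_one_of_le hy))) (by omega)
    rw [hF]
    refine (scanFirst_eq_min (x := Nat.find hex) ?_ (fun y hy => ?_) s).trans
      (min_eq_right (by omega))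
    · rw [hle _ le_rfl]; exact Nat.find_spec hex
    · rw [hle _ hy.le]; exact not_le.1 (Nat.find_min hex hy)
  obtain ⟨c, hc⟩ := exists_code_bounding_settleTime (fun i s => !(F i (s + 1) == F i s))
    (Primrec.not.to_comp.comp (Primrec.beq.to_comp.comp
      (hFc.comp Computable.fst (Computable.succ.comp Computable.snd)) hFc))
    (fun i => by
      obtain ⟨x, T, -, hT⟩ := hFlim i
      exact ⟨T, fun s hs => by simp [hT s hs, hT (s + 1) (by omega)]⟩)
  refine ⟨c, fun k n x hkn hx => ?_⟩
  set i := Nat.pair c k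
  obtain ⟨y, T, hy, hT⟩ := hFlim i
  have hconst : ∀ s ≥ settleTime n, F i s = F i (settleTime n) := by
    intro s hs
    induction s, hs using Nat.le_induction with
    | base => rfl
    | succ s hs ih =>
      rw [← ih]
      by_contra hne
      exact absurd (hc k n s hkn (by simpa using hne)) (by omega)
  have hyF : y = F i (settleTime n) := by
    rw [← hconst _ (le_max_left _ T), hT _ (le_max_right _ _)]
  have hyx : y ≤ x := hyF ▸ (scanFirst_le _ _ _).trans hx
  exact hy.trans (ho.1 hyx)

/-! ### Coding a real at the sparse positions -/

/-- The position of the `k`-th marker. -/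
noncomputable def markerPos (k : ℕ) : ℕ := settleTime k + 2 * k

theorem markerPos_add_two_le (k : ℕ) : markerPos k + 2 ≤ markerPos (k + 1) := by
  have := settleTime_mono (Nat.le_add_right k 1)
  unfold markerPos
  omega

theorem markerPos_strictMono : StrictMono markerPos :=
  strictMono_nat_of_lt_succ fun k => by have := markerPos_add_two_le k; omega

/-- The real with a marker at each `markerPos k`, each followed by the bit `B k`. -/
noncomputable def markedCode (B : Seq2) (m : ℕ) : Bool :=
  open Classical in decide (∃ k, markerPos k = m ∨ (markerPos k + 1 = m ∧ B k = true))

theorem markedCode_eq_true {B : Seq2} {m : ℕ} :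
    markedCode B m = true ↔ ∃ k, markerPos k = m ∨ (markerPos k + 1 = m ∧ B k = true) := by
  simp [markedCode]

theorem markedCode_marker (B : Seq2) (k : ℕ) : markedCode B (markerPos k) = true :=
  markedCode_eq_true.2 ⟨k, Or.inl rfl⟩

theorem markedCode_marker_succ (B : Seq2) (k : ℕ) : markedCode B (markerPos k + 1) = B k := by
  rw [Bool.eq_iff_iff, markedCode_eq_true]
  refine ⟨?_, fun h => ⟨k, Or.inr ⟨rfl, h⟩⟩⟩
  rintro ⟨l, hl | ⟨hl, hB⟩⟩
  · rcases Nat.lt_or_ge k l with h | h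
    · have := markerPos_add_two_le k
      have := markerPos_strictMono.monotone (Nat.add_one_le_of_lt h)
      omega
    · have := markerPos_strictMono.monotone h
      omega
  · rwa [markerPos_strictMono.injective (Nat.succ_injective hl)] at hB

theorem markedCode_eq_false_of_between (B : Seq2) {j m : ℕ} (h : ∀ k < j, markerPos k + 1 < m)
    (h' : m < markerPos j) : markedCode B m = false := by
  refine Bool.eq_false_of_not_eq_true (mt markedCode_eq_true.1 ?_)
  rintro ⟨k, hk⟩
  rcases Nat.lt_or_ge k j with hkj | hkj
  · have := h k hkj
    omega
  · have := markerPos_strictMono.monotone hkj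
    omega

theorem foldl_decodeStep_restrict_markedCode (B : Seq2) (j n : ℕ)
    (h : ∀ k < j, markerPos k + 1 < n) (h' : n ≤ markerPos j) :
    (restrict (markedCode B) n).foldl decodeStep (false, []) = (false, restrict B j) := by
  induction n using Nat.strong_induction_on generalizing j with
  | _ n ih =>
    rcases n with _ | n
    · rcases j with _ | j
      · rfl
      · exact absurd (h 0 j.succ_pos) (by omega)
    · by_cases hlast : ∀ k < j, markerPos k + 1 < n
      · rw [restrict_succ, List.foldl_append, ih n n.lt_succ_self j hlast (by omega),
          markedCode_eq_false_of_between B hlast h']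
        rfl
      · push Not at hlast
        obtain ⟨k, hk, hkn⟩ := hlast
        have hn : n = markerPos k + 1 := by have := h k hk; omega
        have hj : j = k + 1 := by
          by_contra hne
          have h1 := h (k + 1) (by omega)
          have h2 := markerPos_add_two_le k
          omega
        subst hn hj
        have hprev := ih (markerPos k) (by omega) k (fun l hl => by
          have := markerPos_add_two_le l
          have := markerPos_strictMono.monotone (Nat.add_one_le_of_lt hl)
          omega) le_rfl
        rw [restrict_succ, restrict_succ, List.foldl_append, List.foldl_append, hprev,
          markedCode_marker, markedCode_marker_succ, restrict_succ]
        rfl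

theorem decodeMarked_restrict_markedCode (B : Seq2) (n : ℕ) :
    decodeMarked (restrict (markedCode B) (markerPos n)) = restrict B n := by
  rw [decodeMarked, foldl_decodeStep_restrict_markedCode B n _ (fun k hk => ?_) le_rfl]
  have h1 := markerPos_add_two_le k
  have h2 := markerPos_strictMono.monotone (Nat.add_one_le_of_lt hk)
  omega

/-- Recover the first `n` bits of `markedCode B` from `n` and initial segments of
`finitelyActive` and `B`. -/
def decompress (a : ℕ × BinStr × BinStr) : BinStr :=
  (List.range a.1).map fun m => (List.range a.2.1.length).any fun k =>
    (lastEvent (fun i => a.2.1.getD i false) k a.1 + 2 * k == m) ||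
      ((lastEvent (fun i => a.2.1.getD i false) k a.1 + 2 * k + 1 == m) && a.2.2.getD k false)

theorem Primrec.range_any {α : Type*} [Primcodable α] {f : α → ℕ} {p : α → ℕ → Bool}
    (hf : Primrec f) (hp : Primrec₂ p) : Primrec fun x => (List.range (f x)).any (p x) := by
  have h : Primrec fun x => (List.range (f x)).foldr (fun k acc => p x k || acc) false :=
    Primrec.list_foldr (Primrec.list_range.comp hf) (Primrec.const false)
      (Primrec.or.comp (hp.comp Primrec.fst (Primrec.fst.comp Primrec.snd))
        (Primrec.snd.comp Primrec.snd)).to₂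
  refine h.of_eq fun x => ?_
  induction List.range (f x) with
  | nil => rfl
  | cons k l ih => rw [List.foldr_cons, ih, List.any_cons]

theorem primrec_lastEvent_getD :
    Primrec fun p : BinStr × ℕ × ℕ => lastEvent (fun i => p.1.getD i false) p.2.1 p.2.2 := by
  have hev : Primrec fun p : (BinStr × ℕ × ℕ) × (ℕ × ℕ) =>
      eventAt (fun i => p.1.1.getD i false) p.1.2.1 p.2.1 := by
    refine Primrec.range_any (Primrec.fst.comp (Primrec.snd.comp Primrec.fst)) ?_
    exact Primrec.and.comp
      ((Primrec.list_getD false).comp (Primrec.fst.comp (Primrec.fst.comp Primrec.fst)) Primrec.snd)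
      (primrec_firstHalt.comp Primrec.snd (Primrec.fst.comp (Primrec.snd.comp Primrec.fst)))
  refine (Primrec.nat_rec' (f := fun p : BinStr × ℕ × ℕ => p.2.2) (g := fun _ => 0)
    (Primrec.snd.comp Primrec.snd) (Primrec.const 0)
    (Primrec.cond hev (Primrec.succ.comp (Primrec.fst.comp Primrec.snd))
      (Primrec.snd.comp Primrec.snd)).to₂).of_eq fun p => ?_
  obtain ⟨u, k, n⟩ := p
  dsimp only
  induction n with
  | zero => rfl
  | succ n ih => rw [lastEvent, ← ih]

theorem primrec_decompress : Primrec decompress := by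
  refine Primrec.list_map (Primrec.list_range.comp Primrec.fst) ?_
  refine Primrec.range_any (Primrec.list_length.comp
    (Primrec.fst.comp (Primrec.snd.comp Primrec.fst))) ?_
  have ha : Primrec fun p : ((ℕ × BinStr × BinStr) × ℕ) × ℕ => p.1.1 :=
    Primrec.fst.comp Primrec.fst
  have hm : Primrec fun p : ((ℕ × BinStr × BinStr) × ℕ) × ℕ => p.1.2 :=
    Primrec.snd.comp Primrec.fst
  have hx : Primrec fun p : ((ℕ × BinStr × BinStr) × ℕ) × ℕ =>
      lastEvent (fun i => p.1.1.2.1.getD i false) p.2 p.1.1.1 + 2 * p.2 :=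
    Primrec.nat_add.comp
      (primrec_lastEvent_getD.comp (Primrec.pair (Primrec.fst.comp (Primrec.snd.comp ha))
        (Primrec.pair Primrec.snd (Primrec.fst.comp ha))))
      (Primrec.nat_mul.comp (Primrec.const 2) Primrec.snd)
  exact Primrec.or.comp (Primrec.beq.comp hx hm)
    (Primrec.and.comp (Primrec.beq.comp (Primrec.succ.comp hx) hm)
      ((Primrec.list_getD false).comp (Primrec.snd.comp (Primrec.snd.comp ha)) Primrec.snd))

theorem decompress_eq_restrict_markedCode (B : Seq2) {j n : ℕ} (h : ∀ k < j, markerPos k < n)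
    (h' : n ≤ markerPos j) :
    decompress (n, restrict finitelyActive j, restrict B j) = restrict (markedCode B) n := by
  have hpos : ∀ k < j, lastEvent (fun i => (restrict finitelyActive j).getD i false) k n + 2 * k =
      markerPos k := fun k hk => by
    rw [lastEvent_congr (b := finitelyActive)
      (fun i hi => restrict_getD finitelyActive (hi.trans hk) false), lastEvent_eq_settleTime,
      markerPos]
    have := h k hk
    unfold markerPos at this
    omega
  refine List.map_congr_left fun m hm => ?_
  rw [List.mem_range] at hm
  dsimp only at hm
  rw [Bool.eq_iff_iff, List.any_eq_true, markedCode_eq_true]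
  dsimp only
  rw [restrict_length]
  constructor
  · rintro ⟨k, hk, hkm⟩
    rw [List.mem_range] at hk
    rw [hpos k hk, restrict_getD B hk] at hkm
    exact ⟨k, by simpa using hkm⟩
  · rintro ⟨k, hkm⟩
    have hk : k < j := by
      by_contra hk
      have := markerPos_strictMono.monotone (not_lt.1 hk)
      omega
    refine ⟨k, List.mem_range.2 hk, ?_⟩
    rw [hpos k hk, restrict_getD B hk]
    simpa using hkm

theorem exists_pair_interval {c j : ℕ} (h : Nat.pair c 0 + 1 < j) :
    ∃ k, Nat.pair c k + 1 < j ∧ j ≤ Nat.pair c (k + 1) + 1 := by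
  have hex : ∃ k, j ≤ Nat.pair c (k + 1) + 1 :=
    ⟨j, (Nat.le_succ j).trans ((Nat.right_le_pair c (j + 1)).trans (Nat.le_succ _))⟩
  classical
  refine ⟨Nat.find hex, ?_, Nat.find_spec hex⟩
  cases hk : Nat.find hex with
  | zero => exact h
  | succ k => exact not_le.1 (Nat.find_min hex (hk ▸ k.lt_succ_self))

theorem KTDelta_markedCode (U : UniversalPrefixMachine) (B : Seq2) : KTDelta U (markedCode B) := by
  intro g hg ho
  have hq : Computable fun i : ℕ => 4 * (Nat.pair i.unpair.1 (i.unpair.2 + 1) + 1) :=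
    (Primrec.nat_mul.comp (Primrec.const 4) (Primrec.succ.comp (Primrec₂.natPair.comp
      (Primrec.fst.comp Primrec.unpair)
      (Primrec.succ.comp (Primrec.snd.comp Primrec.unpair))))).to_comp
  obtain ⟨c, hc⟩ := exists_le_order_of_settleTime_le hg ho hq
  obtain ⟨d, hd⟩ := exists_Kc_le_KcNat_add_length U decompress primrec_decompress.to_comp
  refine ⟨4 * (Nat.pair c 0 + 1) + d, fun n => ?_⟩
  have hex : ∃ j, n ≤ markerPos j := ⟨n, markerPos_strictMono.le_apply⟩
  classical
  set j := Nat.find hex with hj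
  have hlt : ∀ k < j, markerPos k < n := fun k hk => not_le.1 (Nat.find_min hex hk)
  have hK := hd n (restrict finitelyActive j) (restrict B j)
  rw [decompress_eq_restrict_markedCode B hlt (Nat.find_spec hex), restrict_length,
    restrict_length] at hK
  suffices 4 * j ≤ g n + 4 * (Nat.pair c 0 + 1) by omega
  rcases le_or_gt j (Nat.pair c 0 + 1) with hjc | hjc
  · omega
  · obtain ⟨k, hk, hk'⟩ := exists_pair_interval hjc
    have hset : settleTime (j - 1) ≤ n := by
      have := hlt (j - 1) (by omega)
      unfold markerPos at this
      omega
    have := hc k (j - 1) n (by omega) hset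
    simp only [Nat.unpair_pair] at this
    omega

theorem LK.of_markedCode {U : UniversalPrefixMachine} {f : BinStr → ℕ} {B : Seq2}
    (h : LK U f (markedCode B)) : LK U f B := by
  obtain ⟨c, hc⟩ := h
  obtain ⟨d, hd⟩ := exists_KOr_le_of_decodeMarked U
    fun n => ⟨markerPos n, decodeMarked_restrict_markedCode B n⟩
  refine ⟨c + d, fun σ => ?_⟩
  have h₁ := hc σ
  have h₂ := hd σ
  omega

/-- for any f, either LK(f) = 2^ω or KT(Δ⁰₂) ⊄ LK(f). -/
theorem stmt7 (U : UniversalPrefixMachine) (f : BinStr → ℕ) :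
    (∀ A : Seq2, LK U f A) ∨ ∃ A : Seq2, KTDelta U A ∧ ¬ LK U f A := by
  by_cases h : ∀ A : Seq2, LK U f A
  · exact Or.inl h
  · push Not at h
    obtain ⟨B, hB⟩ := h
    exact Or.inr ⟨markedCode B, KTDelta_markedCode U B, fun h' => hB h'.of_markedCode⟩
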